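/- arXiv:2002.01714 — 5 statements merged into one kernel-verified Lean document; each statement's English description precedes it below -/
import Mathlib

section
/- Let H be a complex Hilbert space and let A, B ∈ B(H) be bounded linear operators with A positive (i.e. ⟪Ax, x⟫ ≥ 0 for all x ∈ H). Then the following assertions are equivalent: (i) there exists C ∈ B(H) such that the block operator on H × H given by (x, y) ↦ (Ax + B*y, Bx + Cy) is positive, i.e. Re⟪Ax + B*y, x⟫ + Re⟪Bx + Cy, y⟫ ≥ 0 for all x, y ∈ H; (ii) there exists a constant m ≥ 0 such that B*B ≤ mA in the Loewner order (i.e. m·A − B*B is a positive operator); (iii) the range of B* is contained in the range of A^{1/2}, the positive square root of A. -/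
open scoped InnerProductSpace ComplexOrder

theorem ps_douglas {H : Type*} [NormedAddCommGroup H] [InnerProductSpace ℂ H] [CompleteSpace H]
    (S B : H →L[ℂ] H) (hS : ∀ x y : H, ⟪S x, y⟫_ℂ = ⟪x, S y⟫_ℂ) (c : ℝ)
    (h : ∀ x, ‖B x‖ ≤ c * ‖S x‖) (y : H) :
    ∃ z, S z = ContinuousLinearMap.adjoint B y := by
  obtain ⟨g, hg⟩ := LinearMap.exists_rightInverse_of_surjective
    (S : H →ₗ[ℂ] H).rangeRestrict (LinearMap.range_rangeRestrict _)
  have hg' : ∀ r : LinearMap.range (S : H →ₗ[ℂ] H), S (g r) = r := fun r =>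
    congrArg Subtype.val (LinearMap.congr_fun hg r)
  have hb : ∀ x, ‖⟪y, B x⟫_ℂ‖ ≤ (‖y‖ * c) * ‖S x‖ := fun x => by
    calc ‖⟪y, B x⟫_ℂ‖ ≤ ‖y‖ * ‖B x‖ := norm_inner_le_norm _ _
      _ ≤ ‖y‖ * (c * ‖S x‖) := by gcongr; exact h x
      _ = _ := by ring
  let φ : H →L[ℂ] ℂ := (innerSL ℂ y).comp B
  let f : LinearMap.range (S : H →ₗ[ℂ] H) →L[ℂ] ℂ :=
    LinearMap.mkContinuous ((φ : H →ₗ[ℂ] ℂ).comp g) (‖y‖ * c) (fun r => by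
      have := hb (g r)
      rw [hg' r] at this
      exact this)
  obtain ⟨F, hF, -⟩ := exists_extension_norm_eq _ f
  refine ⟨(InnerProductSpace.toDual ℂ H).symm F, ?_⟩
  refine ext_inner_right ℂ fun x => ?_
  rw [hS, InnerProductSpace.toDual_symm_apply, ContinuousLinearMap.adjoint_inner_left]
  have h1 := hF ⟨S x, x, rfl⟩
  refine h1.trans ?_
  change ⟪y, B (g ⟨S x, x, rfl⟩)⟫_ℂ = ⟪y, B x⟫_ℂ
  have h2 := hb (g ⟨S x, x, rfl⟩ - x)
  rw [map_sub S, hg', sub_self, norm_zero, mul_zero, map_sub, inner_sub_right] at h2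
  exact sub_eq_zero.1 (norm_le_zero_iff.1 h2)

theorem ps_bound {H : Type*} [NormedAddCommGroup H] [InnerProductSpace ℂ H] [CompleteSpace H]
    (S B : H →L[ℂ] H) (hS : ∀ x y : H, ⟪S x, y⟫_ℂ = ⟪x, S y⟫_ℂ)
    (h : ∀ y, ∃ z, S z = ContinuousLinearMap.adjoint B y) :
    ∃ c : ℝ, ∀ x, ‖B x‖ ≤ c * ‖S x‖ := by
  have key : ∀ y, ∃ z, ∀ x, ⟪B x, y⟫_ℂ = ⟪S x, z⟫_ℂ := fun y => by
    obtain ⟨z, hz⟩ := h y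
    exact ⟨z, fun x => by rw [hS, hz, ContinuousLinearMap.adjoint_inner_right]⟩
  obtain ⟨c, hc⟩ := banach_steinhaus
    (g := fun x : H => (((‖S x‖⁻¹ : ℝ) : ℂ)) • innerSL ℂ (B x)) (fun y => by
      obtain ⟨z, hz⟩ := key y
      refine ⟨‖z‖, fun x => ?_⟩
      change ‖(((‖S x‖⁻¹ : ℝ) : ℂ)) • ⟪B x, y⟫_ℂ‖ ≤ _
      rw [hz, norm_smul, Complex.norm_real, norm_inv, norm_norm]
      by_cases h0 : ‖S x‖ = 0
      · simp [h0]
      · have : 0 < ‖S x‖ := lt_of_le_of_ne (norm_nonneg _) (Ne.symm h0)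
        rw [inv_mul_le_iff₀ this]
        exact norm_inner_le_norm _ _)
  refine ⟨c, fun x => ?_⟩
  by_cases h0 : ‖S x‖ = 0
  · obtain ⟨z, hz⟩ := key (B x)
    have h1 := hz x
    rw [norm_eq_zero.1 h0, inner_zero_left, inner_self_eq_zero] at h1
    simp [h1, h0]
  · have hp : 0 < ‖S x‖ := lt_of_le_of_ne (norm_nonneg _) (Ne.symm h0)
    have h1 := hc x
    rw [norm_smul, Complex.norm_real, norm_inv, norm_norm, innerSL_apply_norm,
      inv_mul_le_iff₀ hp] at h1
    linarith

/-- **Corollary (Pekarev–Šmul'jan).**  For bounded operators `A, B` on a complex Hilbert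
space with `A` positive, the following are equivalent: (i) some `C` makes the block operator
`[[A, B*], [B, C]]` positive; (ii) `B*B ≤ m·A` for some `m ≥ 0`; (iii) `ran B* ⊆ ran A^{1/2}`. -/
theorem pekarev_smuljan
    {H : Type*} [NormedAddCommGroup H] [InnerProductSpace ℂ H] [CompleteSpace H]
    (A B : H →L[ℂ] H) (hA : ∀ x : H, 0 ≤ ⟪A x, x⟫_ℂ) :
    ([∃ C : H →L[ℂ] H, ∀ x y : H,
        0 ≤ (⟪A x + (ContinuousLinearMap.adjoint B) y, x⟫_ℂ).re +
            (⟪B x + C y, y⟫_ℂ).re,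
      ∃ m : ℝ, 0 ≤ m ∧ ∀ x : H,
        0 ≤ ⟪(m • A - (ContinuousLinearMap.adjoint B) * B) x, x⟫_ℂ,
      Set.range ((ContinuousLinearMap.adjoint B) : H → H) ⊆
        Set.range ((CFC.sqrt A : H →L[ℂ] H) : H → H)] : List Prop).TFAE := by
  have hpos : A.IsPositive := (ContinuousLinearMap.isPositive_iff_complex A).2 fun x => by
    have := Complex.nonneg_iff.1 (hA x)
    exact ⟨Complex.ext (by simp) (by simpa using this.2), this.1⟩
  have hA0 : 0 ≤ A := (ContinuousLinearMap.nonneg_iff_isPositive A).2 hpos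
  have hSp : (CFC.sqrt A).IsPositive :=
    (ContinuousLinearMap.nonneg_iff_isPositive _).1 (CFC.sqrt_nonneg A)
  have hSS : CFC.sqrt A * CFC.sqrt A = A := CFC.sqrt_mul_sqrt_self A hA0
  generalize CFC.sqrt A = S at hSp hSS
  have hS : ∀ x y : H, ⟪S x, y⟫_ℂ = ⟪x, S y⟫_ℂ := fun x y => hSp.isSymmetric x y
  have hAx : ∀ x, ⟪A x, x⟫_ℂ = ((‖S x‖ ^ 2 : ℝ) : ℂ) := fun x => by
    rw [← hSS, ContinuousLinearMap.mul_apply, hS, inner_self_eq_norm_sq_to_K]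
    simp
  have hBx : ∀ x, ⟪ContinuousLinearMap.adjoint B (B x), x⟫_ℂ = ((‖B x‖ ^ 2 : ℝ) : ℂ) :=
    fun x => by
      rw [ContinuousLinearMap.adjoint_inner_left, inner_self_eq_norm_sq_to_K]
      simp
  have h2 : ∀ (m : ℝ) (x : H),
      0 ≤ ⟪(m • A - (ContinuousLinearMap.adjoint B) * B) x, x⟫_ℂ ↔
        ‖B x‖ ^ 2 ≤ m * ‖S x‖ ^ 2 := fun m x => by
    have : ⟪(m • A - (ContinuousLinearMap.adjoint B) * B) x, x⟫_ℂ =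
        ((m * ‖S x‖ ^ 2 - ‖B x‖ ^ 2 : ℝ) : ℂ) := by
      rw [ContinuousLinearMap.sub_apply, inner_sub_left, ContinuousLinearMap.mul_apply, hBx,
        ContinuousLinearMap.smul_apply, inner_smul_left_eq_smul, hAx]
      simp
    rw [this, Complex.zero_le_real, sub_nonneg]
  have h1 : ∀ (C : H →L[ℂ] H) (x y : H),
      (⟪A x + (ContinuousLinearMap.adjoint B) y, x⟫_ℂ).re + (⟪B x + C y, y⟫_ℂ).re =
        ‖S x‖ ^ 2 + 2 * (⟪B x, y⟫_ℂ).re + (⟪C y, y⟫_ℂ).re := fun C x y => by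
    rw [inner_add_left, inner_add_left, hAx, ContinuousLinearMap.adjoint_inner_left,
      ← inner_conj_symm y (B x)]
    simp only [Complex.add_re, Complex.ofReal_re, Complex.conj_re]
    ring
  simp only [h1, h2]
  tfae_have 1 → 2 := by
    rintro ⟨C, hC⟩
    refine ⟨‖C‖ + 1, by positivity, fun x => ?_⟩
    have hk : 0 < ‖C‖ + 1 := by positivity
    have ht : 0 < (‖C‖ + 1)⁻¹ := by positivity
    have htk : (‖C‖ + 1)⁻¹ * (‖C‖ + 1) = 1 := inv_mul_cancel₀ hk.ne'
    generalize (‖C‖ + 1)⁻¹ = t at ht htk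
    have h := hC x (((-t : ℝ) : ℂ) • B x)
    have e1 : (⟪B x, ((-t : ℝ) : ℂ) • B x⟫_ℂ).re = -t * ‖B x‖ ^ 2 := by
      rw [inner_smul_right, Complex.re_ofReal_mul, inner_self_eq_norm_sq_to_K]
      norm_cast
    have e2 : (⟪C (((-t : ℝ) : ℂ) • B x), ((-t : ℝ) : ℂ) • B x⟫_ℂ).re
        ≤ t ^ 2 * (‖C‖ * ‖B x‖ ^ 2) := by
      rw [map_smul, inner_smul_right, inner_smul_left, Complex.conj_ofReal,
        Complex.re_ofReal_mul, Complex.re_ofReal_mul]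
      have : (⟪C (B x), B x⟫_ℂ).re ≤ ‖C‖ * ‖B x‖ ^ 2 := by
        calc (⟪C (B x), B x⟫_ℂ).re ≤ ‖⟪C (B x), B x⟫_ℂ‖ := Complex.re_le_norm _
          _ ≤ ‖C (B x)‖ * ‖B x‖ := norm_inner_le_norm _ _
          _ ≤ (‖C‖ * ‖B x‖) * ‖B x‖ := by gcongr; exact C.le_opNorm _
          _ = _ := by ring
      nlinarith [mul_le_mul_of_nonneg_left this (sq_nonneg t)]
    rw [e1] at h
    have h3 : t * ‖B x‖ ^ 2 ≤ ‖S x‖ ^ 2 := by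
      have : t ^ 2 * (‖C‖ * ‖B x‖ ^ 2) = t * ‖B x‖ ^ 2 - t ^ 2 * ‖B x‖ ^ 2 := by
        linear_combination (t * ‖B x‖ ^ 2) * htk
      nlinarith [mul_nonneg (sq_nonneg t) (sq_nonneg ‖B x‖)]
    calc ‖B x‖ ^ 2 = (‖C‖ + 1) * (t * ‖B x‖ ^ 2) := by
          linear_combination (-‖B x‖ ^ 2) * htk
      _ ≤ _ := by gcongr
  tfae_have 2 → 1 := by
    rintro ⟨m, hm, h⟩
    refine ⟨((m : ℝ) : ℂ) • ContinuousLinearMap.id ℂ H, fun x y => ?_⟩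
    have e : (⟪(((m : ℝ) : ℂ) • ContinuousLinearMap.id ℂ H) y, y⟫_ℂ).re = m * ‖y‖ ^ 2 := by
      rw [ContinuousLinearMap.smul_apply, ContinuousLinearMap.id_apply, inner_smul_left,
        Complex.conj_ofReal, Complex.re_ofReal_mul, inner_self_eq_norm_sq_to_K]
      norm_cast
    rw [e]
    have hb : ‖B x‖ ≤ √m * ‖S x‖ := by
      refine (sq_le_sq₀ (norm_nonneg _) (by positivity)).1 ?_
      rw [mul_pow, Real.sq_sqrt hm]
      exact h x
    have h3 : -(⟪B x, y⟫_ℂ).re ≤ √m * ‖S x‖ * ‖y‖ := by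
      calc -(⟪B x, y⟫_ℂ).re ≤ |(⟪B x, y⟫_ℂ).re| := neg_le_abs _
        _ ≤ ‖⟪B x, y⟫_ℂ‖ := Complex.abs_re_le_norm _
        _ ≤ ‖B x‖ * ‖y‖ := norm_inner_le_norm _ _
        _ ≤ _ := by gcongr
    have h4 : m * ‖y‖ ^ 2 = (√m * ‖y‖) ^ 2 := by rw [mul_pow, Real.sq_sqrt hm]
    rw [h4]
    nlinarith [sq_nonneg (‖S x‖ - √m * ‖y‖)]
  tfae_have 2 → 3 := by
    rintro ⟨m, hm, h⟩ _ ⟨y, rfl⟩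
    refine ps_douglas S B hS √m (fun x => ?_) y
    refine (sq_le_sq₀ (norm_nonneg _) (by positivity)).1 ?_
    rw [mul_pow, Real.sq_sqrt hm]
    exact h x
  tfae_have 3 → 2 := by
    intro h
    obtain ⟨c, hc⟩ := ps_bound S B hS (fun y => h ⟨y, rfl⟩)
    refine ⟨c ^ 2, sq_nonneg c, fun x => ?_⟩
    rw [← mul_pow]
    exact pow_le_pow_left₀ (norm_nonneg _) (hc x) 2
  tfae_finish
end

section
/- Let E be a complex vector space and let a and b be nonnegative sesquilinear forms on E. Then there exists a (necessarily unique) nonnegative sesquilinear form a : b on E, called the parallel sum of a and b, such that for every y ∈ E, (a : b)(y, y) = inf{ a(y + x, y + x) + b(x, x) : x ∈ E }. Moreover (a : b)(y, y) ≤ a(y, y) for all y ∈ E, and a : b = b : a. -/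
open Complex
open scoped ComplexOrder


lemma par_herm {F : Type*} [AddCommGroup F] [Module ℂ F]
    (t : F →ₗ[ℂ] F →ₗ⋆[ℂ] ℂ) (ht : ∀ x, 0 ≤ t x x) (x y : F) :
    (starRingEnd ℂ) (t x y) = t y x := by
  have im0 : ∀ x, (t x x).im = 0 := fun x => ((Complex.nonneg_iff.1 (ht x)).2).symm
  have h1 := im0 (x + y)
  have h2 := im0 (x + Complex.I • y)
  have hx := im0 x
  have hy := im0 y
  simp at h1 h2
  apply Complex.ext
  · simp
    linarith
  · simp
    linarith

lemma par_ext {F : Type*} [AddCommGroup F] [Module ℂ F]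
    (s t : F →ₗ[ℂ] F →ₗ⋆[ℂ] ℂ) (h : ∀ x, s x x = t x x) : s = t := by
  ext x y
  have h1 := h (x + y)
  have h2 := h (x + Complex.I • y)
  have hx := h x
  have hy := h y
  simp at h1 h2
  have e1 : s x y + s y x = t x y + t y x := by linear_combination h1 - hx - hy
  have hI := Complex.I_mul_I
  have e2 : s x y - s y x = t x y - t y x := by
    linear_combination Complex.I * h2 - Complex.I * hx - Complex.I * Complex.I * (-Complex.I) * hy
      + (s x y - s y x - t x y + t y x) * hI
  linear_combination (e1 + e2) / 2

lemma par_repr.{u} {F : Type u} [AddCommGroup F] [Module ℂ F]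
    (t : F →ₗ[ℂ] F →ₗ⋆[ℂ] ℂ) (ht : ∀ x, 0 ≤ t x x) :
    ∃ (H : Type u) (_ : NormedAddCommGroup H) (_ : InnerProductSpace ℂ H) (_ : CompleteSpace H)
      (J : F →ₗ[ℂ] H), ∀ x y, inner ℂ (J y) (J x) = t x y := by
  let c : PreInnerProductSpace.Core ℂ F :=
    { inner := fun x y => t y x
      conj_inner_symm := fun x y => par_herm t ht x y
      re_inner_nonneg := fun x => (Complex.nonneg_iff.1 (ht x)).1
      add_left := fun x y z => by simp
      smul_left := fun x y r => by simp }
  let _ : SeminormedAddCommGroup F := InnerProductSpace.Core.toSeminormedAddCommGroup (c := c)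
  let _ : InnerProductSpace ℂ F := InnerProductSpace.ofCore c
  refine ⟨UniformSpace.Completion F, inferInstance, inferInstance, inferInstance,
    (UniformSpace.Completion.toComplL (𝕜 := ℂ) (E := F)).toLinearMap, fun x y => ?_⟩
  exact UniformSpace.Completion.inner_coe y x

lemma par_dist {H : Type*} [NormedAddCommGroup H] [InnerProductSpace ℂ H] [CompleteSpace H]
    (M : Submodule ℂ H) (v : H) :
    IsGLB {r : ℝ | ∃ m ∈ M, r = ‖v + m‖ ^ 2} (‖M.topologicalClosureᗮ.starProjection v‖ ^ 2) := by
  have : CompleteSpace M.topologicalClosure := M.isClosed_topologicalClosure.completeSpace_coe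
  set K := M.topologicalClosure with hK
  set w := Kᗮ.starProjection v with hw
  have hwK : w ∈ Kᗮ := Submodule.starProjection_apply_mem _ _
  have hv : v - w ∈ K := by
    have : v - w = K.starProjection v := by
      rw [hw, Submodule.starProjection_orthogonal_val]; abel
    rw [this]; exact Submodule.starProjection_apply_mem _ _
  have key : ∀ m ∈ M, ‖v + m‖ ^ 2 = ‖w‖ ^ 2 + ‖(v - w) + m‖ ^ 2 := by
    intro m hm
    have h0 : inner ℂ w ((v - w) + m) = 0 :=
      Submodule.inner_left_of_mem_orthogonal (K.add_mem hv (M.le_topologicalClosure hm)) hwK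
    have := norm_add_sq_eq_norm_sq_add_norm_sq_of_inner_eq_zero w ((v - w) + m) h0
    have e : w + ((v - w) + m) = v + m := by abel
    rw [e] at this
    nlinarith
  constructor
  · rintro r ⟨m, hm, rfl⟩
    rw [key m hm]
    nlinarith [sq_nonneg ‖(v - w) + m‖]
  · intro l hl
    apply le_of_forall_pos_le_add
    intro ε hε
    have hv' : v - w ∈ closure (M : Set H) := hv
    obtain ⟨m, hm, hd⟩ := Metric.mem_closure_iff.1 hv' (√ε) (Real.sqrt_pos.2 hε)
    have h1 := hl ⟨-m, M.neg_mem hm, rfl⟩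
    rw [key _ (M.neg_mem hm), ← sub_eq_add_neg (v - w) m, ← dist_eq_norm] at h1
    have h2 : dist (v - w) m ^ 2 ≤ ε := by
      have := Real.sq_sqrt hε.le
      nlinarith [dist_nonneg (x := v - w) (y := m), Real.sqrt_nonneg ε]
    linarith

/-- **Parallel sum of nonnegative sesquilinear forms.**  There is a unique nonnegative
sesquilinear form `a : b` whose quadratic form is
`(a : b)(y,y) = inf { a(y+x, y+x) + b(x,x) : x ∈ E }`; moreover `(a : b)(y,y) ≤ a(y,y)` and
`a : b = b : a`. -/
theorem exists_parallel_sum_form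
    {E : Type*} [AddCommGroup E] [Module ℂ E]
    (a b : E →ₗ[ℂ] E →ₗ⋆[ℂ] ℂ) (ha : ∀ x, 0 ≤ a x x) (hb : ∀ x, 0 ≤ b x x) :
    ∃ p : E →ₗ[ℂ] E →ₗ⋆[ℂ] ℂ, (∀ y, 0 ≤ p y y) ∧
      (∀ y : E, (p y y).re =
        sInf {r : ℝ | ∃ x : E, r = (a (y + x) (y + x)).re + (b x x).re}) ∧
      (∀ y : E, (p y y).re ≤ (a y y).re) ∧
      (∀ q : E →ₗ[ℂ] E →ₗ⋆[ℂ] ℂ, (∀ y, 0 ≤ q y y) →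
        (∀ y : E, (q y y).re =
          sInf {r : ℝ | ∃ x : E, r = (a (y + x) (y + x)).re + (b x x).re}) → q = p) ∧
      (∀ q : E →ₗ[ℂ] E →ₗ⋆[ℂ] ℂ, (∀ y, 0 ≤ q y y) →
        (∀ y : E, (q y y).re =
          sInf {r : ℝ | ∃ x : E, r = (b (y + x) (y + x)).re + (a x x).re}) → q = p) := by
  let t : (E × E) →ₗ[ℂ] (E × E) →ₗ⋆[ℂ] ℂ :=
    LinearMap.mk₂'ₛₗ (RingHom.id ℂ) (starRingEnd ℂ) (fun u v => a u.1 v.1 + b u.2 v.2)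
      (fun u v w => by simp; ring) (fun c u v => by simp; ring)
      (fun u v w => by simp; ring) (fun c u v => by simp; ring)
  have ht : ∀ u, 0 ≤ t u u := fun u => add_nonneg (ha u.1) (hb u.2)
  obtain ⟨H, _, _, _, J, hJ⟩ := par_repr t ht
  let D : E →ₗ[ℂ] H := J ∘ₗ (LinearMap.prod LinearMap.id LinearMap.id)
  let M : Submodule ℂ H := LinearMap.range D
  let G : E →ₗ[ℂ] H := (M.topologicalClosureᗮ.starProjection).toLinearMap ∘ₗ J ∘ₗ
    (LinearMap.inl ℂ E E)
  let p : E →ₗ[ℂ] E →ₗ⋆[ℂ] ℂ :=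
    LinearMap.mk₂'ₛₗ (RingHom.id ℂ) (starRingEnd ℂ) (fun y z => inner ℂ (G z) (G y))
      (fun u v w => by simp [inner_add_right]) (fun c u v => by simp [inner_smul_right])
      (fun u v w => by simp [inner_add_left]) (fun c u v => by simp [mul_comm])
  have hpn : ∀ y, p y y = ((‖G y‖ ^ 2 : ℝ) : ℂ) := fun y => by
    have := inner_self_eq_norm_sq_to_K (𝕜 := ℂ) (G y)
    simpa [p] using this
  have hp0 : ∀ y, 0 ≤ p y y := fun y => by
    rw [hpn]; exact_mod_cast sq_nonneg ‖G y‖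
  have hset : ∀ y, {r : ℝ | ∃ x : E, r = (a (y + x) (y + x)).re + (b x x).re} =
      {r : ℝ | ∃ m ∈ M, r = ‖J (y, 0) + m‖ ^ 2} := by
    intro y
    have e : ∀ x, ‖J (y, 0) + D x‖ ^ 2 = (a (y + x) (y + x)).re + (b x x).re := by
      intro x
      have h1 : J (y, 0) + D x = J (y + x, x) := by
        simp [D, ← map_add]
      have h2 := inner_self_eq_norm_sq (𝕜 := ℂ) (J (y + x, x))
      rw [hJ] at h2
      rw [h1, ← h2]
      rfl
    ext r
    constructor
    · rintro ⟨x, rfl⟩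
      exact ⟨D x, ⟨x, rfl⟩, (e x).symm⟩
    · rintro ⟨_, ⟨x, rfl⟩, rfl⟩
      exact ⟨x, e x⟩
  have hglb : ∀ y, IsGLB {r : ℝ | ∃ x : E, r = (a (y + x) (y + x)).re + (b x x).re}
      (p y y).re := by
    intro y
    rw [hset, hpn, Complex.ofReal_re]
    exact par_dist M (J (y, 0))
  have hinf : ∀ y, (p y y).re =
      sInf {r : ℝ | ∃ x : E, r = (a (y + x) (y + x)).re + (b x x).re} := fun y =>
    ((hglb y).csInf_eq ⟨_, 0, rfl⟩).symm
  have huniq : ∀ q : E →ₗ[ℂ] E →ₗ⋆[ℂ] ℂ, (∀ y, 0 ≤ q y y) →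
        (∀ y : E, (q y y).re =
          sInf {r : ℝ | ∃ x : E, r = (a (y + x) (y + x)).re + (b x x).re}) → q = p := by
    intro q hq hq'
    apply par_ext
    intro x
    apply Complex.ext
    · rw [hq', hinf]
    · rw [← (Complex.nonneg_iff.1 (hq x)).2, ← (Complex.nonneg_iff.1 (hp0 x)).2]
  refine ⟨p, hp0, hinf, fun y => (hglb y).1 ⟨0, by simp⟩, huniq, ?_⟩
  intro q hq hq'
  apply huniq q hq
  intro y
  rw [hq']
  congr 1
  ext r
  constructor
  · rintro ⟨x, rfl⟩
    refine ⟨-(y + x), ?_⟩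
    have : y + -(y + x) = -x := by abel
    rw [this]
    simp only [map_neg, LinearMap.neg_apply, neg_neg]
    ring
  · rintro ⟨x, rfl⟩
    refine ⟨-(y + x), ?_⟩
    have : y + -(y + x) = -x := by abel
    rw [this]
    simp only [map_neg, LinearMap.neg_apply, neg_neg]
    ring
end

section
/- Let E be a complex vector space and let a and b be nonnegative sesquilinear forms on E. For each natural number n ≥ 1 let a : (n·b) denote the parallel sum, determined by (a : n·b)(y, y) = inf{ a(y + x, y + x) + n·b(x, x) : x ∈ E }. Then for every y ∈ E the sequence n ↦ (a : n·b)(y, y) is nondecreasing and bounded above by a(y, y), hence convergent, and its limit satisfies lim_{n→∞} (a : n·b)(y, y) = sup{ (a : b)(x + y, x + y) − b(x, x) : x ∈ E }; in particular this supremum is finite, i.e. the parallel difference (a : b) ÷ b exists and lim_{n→∞} a : (n·b) = (a : b) ÷ b. -/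
open Complex Filter Topology
open scoped ComplexOrder

theorem form_quad_aux {E : Type*} [AddCommGroup E] [Module ℂ E]
    (t : E →ₗ[ℂ] E →ₗ⋆[ℂ] ℂ) (x v : E) (s : ℝ) :
    (t (x + (s : ℂ) • v) (x + (s : ℂ) • v)).re =
      (t x x).re + s * ((t x v).re + (t v x).re) + s ^ 2 * (t v v).re := by
  simp only [map_add, LinearMap.add_apply, map_smul, LinearMap.smul_apply, LinearMap.map_smulₛₗ,
    Complex.conj_ofReal, RingHom.id_apply, smul_eq_mul, Complex.add_re, Complex.re_ofReal_mul]
  ring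

/-- **Formula (2.11): `lim_n a : (n·b) = (a : b) ÷ b` in the form setting.**
If `p n` is the parallel sum `a : (n·b)` for `n ≥ 1`, then for every `y` the sequence
`n ↦ (p n)(y,y)` is nondecreasing, bounded above by `a(y,y)`, and converges to
`sup { (a : b)(x+y, x+y) − b(x,x) : x ∈ E }` (in particular this supremum is finite, i.e.
the parallel difference `(a : b) ÷ b` exists). -/
theorem tendsto_parallel_sum_nsmul
    {E : Type*} [AddCommGroup E] [Module ℂ E]
    (a b : E →ₗ[ℂ] E →ₗ⋆[ℂ] ℂ) (ha : ∀ x, 0 ≤ a x x) (hb : ∀ x, 0 ≤ b x x)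
    (p : ℕ → (E →ₗ[ℂ] E →ₗ⋆[ℂ] ℂ))
    (hpn : ∀ n : ℕ, 1 ≤ n → ∀ y, 0 ≤ p n y y)
    (hp : ∀ n : ℕ, 1 ≤ n → ∀ y : E, (p n y y).re =
      sInf {r : ℝ | ∃ x : E, r = (a (y + x) (y + x)).re + (n : ℝ) * (b x x).re}) :
    ∀ y : E,
      (∀ m n : ℕ, 1 ≤ m → m ≤ n → (p m y y).re ≤ (p n y y).re) ∧
      (∀ n : ℕ, 1 ≤ n → (p n y y).re ≤ (a y y).re) ∧
      (∃ L : ℝ, Tendsto (fun n : ℕ => (p n y y).re) atTop (𝓝 L) ∧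
        IsLUB {r : ℝ | ∃ x : E, r = (p 1 (x + y) (x + y)).re - (b x x).re} L) := by
  have hA : ∀ x, 0 ≤ (a x x).re := fun x => (Complex.le_def.1 (ha x)).1
  have hB : ∀ x, 0 ≤ (b x x).re := fun x => (Complex.le_def.1 (hb x)).1
  have hle : ∀ n : ℕ, 1 ≤ n → ∀ y x : E,
      (p n y y).re ≤ (a (y + x) (y + x)).re + (n : ℝ) * (b x x).re := by
    intro n hn y x
    rw [hp n hn y]
    refine csInf_le ⟨0, ?_⟩ ⟨x, rfl⟩
    rintro r ⟨z, rfl⟩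
    have := hA (y + z)
    have := hB z
    positivity
  have hge : ∀ n : ℕ, 1 ≤ n → ∀ (y : E) (c : ℝ),
      (∀ x, c ≤ (a (y + x) (y + x)).re + (n : ℝ) * (b x x).re) → c ≤ (p n y y).re := by
    intro n hn y c h
    rw [hp n hn y]
    refine le_csInf ⟨_, 0, rfl⟩ ?_
    rintro r ⟨z, rfl⟩
    exact h z
  have hex : ∀ n : ℕ, 1 ≤ n → ∀ (y : E) (ε : ℝ), 0 < ε →
      ∃ x, (a (y + x) (y + x)).re + (n : ℝ) * (b x x).re < (p n y y).re + ε := by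
    intro n hn y ε hε
    by_contra! h
    have := hge n hn y _ h
    linarith
  intro y
  have hmono : ∀ m n : ℕ, 1 ≤ m → m ≤ n → (p m y y).re ≤ (p n y y).re := by
    intro m n hm hmn
    refine hge n (hm.trans hmn) y _ fun x => (hle m hm y x).trans ?_
    have h1 : (m : ℝ) ≤ n := by exact_mod_cast hmn
    have := mul_le_mul_of_nonneg_right h1 (hB x)
    linarith
  have hbd : ∀ n : ℕ, 1 ≤ n → (p n y y).re ≤ (a y y).re := by
    intro n hn
    simpa using hle n hn y 0
  refine ⟨hmono, hbd, ?_⟩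
  have hm' : Monotone (fun n : ℕ => (p (n + 1) y y).re) :=
    fun m n h => hmono _ _ (by omega) (by omega)
  have hb' : BddAbove (Set.range (fun n : ℕ => (p (n + 1) y y).re)) := by
    refine ⟨(a y y).re, ?_⟩
    rintro _ ⟨n, rfl⟩
    exact hbd _ (by omega)
  have ht := tendsto_atTop_ciSup hm' hb'
  have hub := fun n : ℕ => le_ciSup hb' n
  set L := ⨆ n : ℕ, (p (n + 1) y y).re with hL
  refine ⟨L, (tendsto_add_atTop_iff_nat 1).1 ht, ?_, ?_⟩
  · rintro r ⟨x, rfl⟩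
    have key : ∀ k : ℕ, (p 1 (x + y) (x + y)).re - (b x x).re ≤
        L + (b x x).re * (1 / ((k : ℝ) + 1)) := by
      intro k
      set s : ℝ := 1 / ((k : ℝ) + 1) with hs
      have hk : (0 : ℝ) < (k : ℝ) + 1 := by positivity
      have hsp : 0 < s := by positivity
      have hks : ((k : ℝ) + 1) * s = 1 := by rw [hs]; field_simp
      have h1 : (p 1 (x + y) (x + y)).re - (b x x).re - (b x x).re * s
          ≤ (p (k + 1 + 1) y y).re := by
        refine hge _ (by omega) y _ fun w => ?_
        have h2 := hle 1 le_rfl (x + y) (w + ((-1 : ℝ) : ℂ) • x)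
        have e : x + y + (w + ((-1 : ℝ) : ℂ) • x) = y + w := by
          push_cast
          module
        rw [e, form_quad_aux] at h2
        have h3 := hB (w + (s : ℂ) • x)
        rw [form_quad_aux] at h3
        have h4 := mul_nonneg hk.le h3
        have h5 : ((k : ℝ) + 1) * ((b w w).re + s * ((b w x).re + (b x w).re) + s ^ 2 * (b x x).re)
            = ((k : ℝ) + 1) * (b w w).re + ((b w x).re + (b x w).re) + s * (b x x).re := by
          linear_combination ((b w x).re + (b x w).re + s * (b x x).re) * hks
        rw [h5] at h4
        push_cast at h2 ⊢
        linarith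
      have := hub (k + 1)
      linarith
    have hlim : Tendsto (fun k : ℕ => L + (b x x).re * (1 / ((k : ℝ) + 1))) atTop
        (𝓝 (L + (b x x).re * 0)) :=
      (tendsto_one_div_add_atTop_nhds_zero_nat.const_mul _).const_add _
    rw [mul_zero, add_zero] at hlim
    exact ge_of_tendsto' hlim key
  · intro c hc
    refine ciSup_le fun k => ?_
    obtain ⟨n, hn⟩ : ∃ n : ℕ, n = k + 1 := ⟨_, rfl⟩
    rw [← hn]
    have hn1 : 1 ≤ n := by omega
    have hN1 : (1 : ℝ) ≤ n := by exact_mod_cast hn1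
    refine le_of_forall_pos_le_add fun δ hδ => ?_
    set s : ℝ := 1 / (n : ℝ) with hs
    have hsp : 0 < s := by positivity
    have hns : (n : ℝ) * s = 1 := by rw [hs]; field_simp
    have hs1 : s ≤ 1 := by nlinarith
    obtain ⟨w, hw⟩ := hex n hn1 y (s * δ) (by positivity)
    have hc' := hc ⟨((1 - n : ℝ) : ℂ) • w, rfl⟩
    have h0 : (p n y y).re - δ + (1 - n : ℝ) ^ 2 * (b w w).re ≤
        (p 1 (((1 - n : ℝ) : ℂ) • w + y) (((1 - n : ℝ) : ℂ) • w + y)).re := by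
      refine hge 1 le_rfl _ _ fun z => ?_
      obtain ⟨v, rfl⟩ : ∃ v, z = v + ((n : ℝ) : ℂ) • w := ⟨z - ((n : ℝ) : ℂ) • w, by module⟩
      have e : ((1 - n : ℝ) : ℂ) • w + y + (v + ((n : ℝ) : ℂ) • w)
          = (y + w) + ((1 : ℝ) : ℂ) • v := by
        push_cast
        module
      rw [e, form_quad_aux, form_quad_aux]
      have h2 := hle n hn1 y (w + (s : ℂ) • v)
      rw [← add_assoc, form_quad_aux, form_quad_aux] at h2
      have h0' := hle n hn1 y w
      have hAv := hA v
      have hBw := hB w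
      have hBv := hB v
      generalize (a (y + w) v).re + (a v (y + w)).re = Ra at *
      have hcomm : (b v w).re + (b w v).re = (b w v).re + (b v w).re := add_comm _ _
      rw [hcomm]
      generalize (b w v).re + (b v w).re = Rb at *
      generalize (a (y + w) (y + w)).re = A0 at *
      generalize (a v v).re = Av at *
      generalize (b w w).re = B0 at *
      generalize (b v v).re = Bv at *
      generalize (p n y y).re = P at *
      have h3 : 0 ≤ (n : ℝ) * (s * Ra + s ^ 2 * Av + n * (s * Rb + s ^ 2 * Bv) + s * δ) :=
        mul_nonneg (by linarith) (by linarith)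
      have h4 : (n : ℝ) * (s * Ra + s ^ 2 * Av + n * (s * Rb + s ^ 2 * Bv) + s * δ)
          = Ra + s * Av + n * Rb + Bv + δ := by
        linear_combination (Ra + s * Av + n * Rb + δ + Bv * (n * s + 1)) * hns
      rw [h4] at h3
      have h5 : s * Av ≤ Av := by nlinarith
      have h6 : B0 ≤ n * B0 := by nlinarith
      push_cast
      nlinarith
    have e2 := form_quad_aux b 0 w (1 - n : ℝ)
    simp only [zero_add, map_zero, LinearMap.zero_apply, Complex.zero_re, mul_zero, add_zero] at e2
    rw [e2] at hc'
    linarith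
end

section
/- Let E be a complex vector space and let a and b be nonnegative sesquilinear forms on E, and let a_r denote the nonnegative form determined by a_r(y, y) = lim_{n→∞} (a : n·b)(y, y). Then for every y ∈ E, a_r(y, y) = sup{ 2·Re(b(x, y)) − b(x, x) + (a : b)(x, x) : x ∈ E } − b(y, y); that is, a_r = (b − b : a)_b − b, where (b − b : a)_b is the smallest nonnegative sesquilinear form d on E satisfying (b(x,x) − (b : a)(x,x)) + 2·Re(b(x,y)) + d(y,y) ≥ 0 for all x, y ∈ E. -/
open Complex Filter Topology
open scoped ComplexOrder

theorem aux_symm {E : Type*} [AddCommGroup E] [Module ℂ E]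
    (b : E →ₗ[ℂ] E →ₗ⋆[ℂ] ℂ) (hb : ∀ x, 0 ≤ b x x) (x y : E) : (b x y).re = (b y x).re := by
  have h1 := (Complex.le_def.1 (hb (x + Complex.I • y))).2
  have h2 := (Complex.le_def.1 (hb x)).2
  have h3 := (Complex.le_def.1 (hb y)).2
  simp at h1 h2 h3
  linarith

theorem aux_quad {E : Type*} [AddCommGroup E] [Module ℂ E]
    (b : E →ₗ[ℂ] E →ₗ⋆[ℂ] ℂ) (hb : ∀ x, 0 ≤ b x x) (x y : E) (t : ℝ) :
    (b (x + (t : ℂ) • y) (x + (t : ℂ) • y)).re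
      = (b x x).re + 2 * t * (b x y).re + t ^ 2 * (b y y).re := by
  have h := aux_symm b hb x y
  simp only [map_add, LinearMap.add_apply, map_smul, LinearMap.smul_apply,
    LinearMap.map_smulₛₗ, Complex.conj_ofReal, smul_eq_mul, Complex.add_re, Complex.re_ofReal_mul]
  rw [← h]
  ring

theorem aux_upper {E : Type*} [AddCommGroup E] [Module ℂ E]
    (a b : E →ₗ[ℂ] E →ₗ⋆[ℂ] ℂ) (ha : ∀ x, 0 ≤ a x x) (hb : ∀ x, 0 ≤ b x x)
    (ab : E →ₗ[ℂ] E →ₗ⋆[ℂ] ℂ)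
    (hab : ∀ y : E, (ab y y).re =
      sInf {r : ℝ | ∃ x : E, r = (a (y + x) (y + x)).re + (b x x).re})
    (y : E) (M : ℝ)
    (har : Tendsto (fun n : ℕ =>
        sInf {r : ℝ | ∃ x : E, r = (a (y + x) (y + x)).re + (n : ℝ) * (b x x).re})
      atTop (𝓝 M)) (x : E) :
    2 * (b x y).re - (b x x).re + (ab x x).re ≤ M + (b y y).re := by
  have ha' : ∀ x, 0 ≤ (a x x).re := fun x => (Complex.le_def.1 (ha x)).1
  have hb' : ∀ x, 0 ≤ (b x x).re := fun x => (Complex.le_def.1 (hb x)).1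
  set u : E := y - x with hu
  have hbu : (b u u).re = (b y y).re - 2 * (b x y).re + (b x x).re := by
    have := aux_quad b hb y x (-1)
    rw [aux_symm b hb x y]
    rw [show u = y + ((-1 : ℝ) : ℂ) • x by simp [hu, sub_eq_add_neg], this]
    ring
  have key : ∀ e : ℝ, 0 < e → (ab x x).re ≤ M + (b u u).re + e * (1 + (b u u).re) := by
    intro e he
    have h1 := har.eventually (gt_mem_nhds (show M < M + e by linarith))
    obtain ⟨n, hn, hn2⟩ := (h1.and
      ((tendsto_natCast_atTop_atTop (R := ℝ)).eventually_ge_atTop (1 + 1 / e))).exists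
    obtain ⟨r, ⟨z, rfl⟩, hz⟩ := exists_lt_of_csInf_lt
      (s := {r : ℝ | ∃ x : E, r = (a (y + x) (y + x)).re + (n : ℝ) * (b x x).re})
      ⟨_, ⟨0, rfl⟩⟩ hn
    have h2 : (ab x x).re ≤ (a (y + z) (y + z)).re + (b (u + z) (u + z)).re := by
      rw [hab x]
      apply csInf_le
      · exact ⟨0, by rintro _ ⟨w, rfl⟩; linarith [ha' (x + w), hb' w]⟩
      · refine ⟨u + z, ?_⟩
        rw [show x + (u + z) = y + z by rw [hu]; abel]
    have h3 := aux_quad b hb u z 1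
    have h4 := aux_quad b hb u z (-(1 / e))
    have h5 := hb' (u + ((-(1 / e) : ℝ) : ℂ) • z)
    rw [h4] at h5
    have h6 : 0 ≤ e * (b u u).re - 2 * (b u z).re + (1 / e) * (b z z).re := by
      have := mul_nonneg he.le h5
      field_simp at this ⊢
      linarith
    have h7 := mul_le_mul_of_nonneg_right hn2 (hb' z)
    simp only [Complex.ofReal_one, one_smul] at h3
    rw [h3] at h2
    linarith
  have : (ab x x).re ≤ M + (b u u).re := by
    have hp : 0 < 1 + (b u u).re := by linarith [hb' u]
    apply le_of_forall_pos_le_add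
    intro d hd
    have := key (d / (1 + (b u u).re)) (div_pos hd hp)
    rwa [div_mul_cancel₀ _ hp.ne'] at this
  linarith

theorem aux_lower {E : Type*} [AddCommGroup E] [Module ℂ E]
    (a b : E →ₗ[ℂ] E →ₗ⋆[ℂ] ℂ) (ha : ∀ x, 0 ≤ a x x) (hb : ∀ x, 0 ≤ b x x)
    (ab : E →ₗ[ℂ] E →ₗ⋆[ℂ] ℂ)
    (hab : ∀ y : E, (ab y y).re =
      sInf {r : ℝ | ∃ x : E, r = (a (y + x) (y + x)).re + (b x x).re})
    (y : E) (s : ℝ)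
    (hs : ∀ x, 2 * (b x y).re - (b x x).re + (ab x x).re ≤ s) (n : ℕ) (hn : 1 ≤ n) :
    sInf {r : ℝ | ∃ x : E, r = (a (y + x) (y + x)).re + (n : ℝ) * (b x x).re}
      ≤ s - (b y y).re := by
  have ha' : ∀ x, 0 ≤ (a x x).re := fun x => (Complex.le_def.1 (ha x)).1
  have hb' : ∀ x, 0 ≤ (b x x).re := fun x => (Complex.le_def.1 (hb x)).1
  have hn1 : (1 : ℝ) ≤ n := by exact_mod_cast hn
  have hn0 : (0 : ℝ) < n := by linarith
  set m := sInf {r : ℝ | ∃ x : E, r = (a (y + x) (y + x)).re + (n : ℝ) * (b x x).re} with hm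
  have hmle : ∀ z, m ≤ (a (y + z) (y + z)).re + (n : ℝ) * (b z z).re := by
    intro z
    apply csInf_le
    · exact ⟨0, by
        rintro _ ⟨w, rfl⟩
        linarith [ha' (y + w), mul_nonneg hn0.le (hb' w)]⟩
    · exact ⟨z, rfl⟩
  apply le_of_forall_pos_le_add
  intro d hd
  obtain ⟨r, ⟨z, rfl⟩, hz⟩ := exists_lt_of_csInf_lt
    (s := {r : ℝ | ∃ x : E, r = (a (y + x) (y + x)).re + (n : ℝ) * (b x x).re})
    ⟨_, ⟨0, rfl⟩⟩ (show m < m + d / n by linarith [div_pos hd hn0])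
  -- the test vector
  set x : E := y + ((1 - n : ℝ) : ℂ) • z with hx
  have h1 : (a (y + z) (y + z)).re + (n : ℝ) ^ 2 * (b z z).re - d ≤ (ab x x).re := by
    rw [hab x]
    refine le_csInf (s := {r : ℝ | ∃ w : E, r = (a (x + w) (x + w)).re + (b w w).re})
      ⟨_, ⟨0, rfl⟩⟩ ?_
    rintro _ ⟨w, rfl⟩
    obtain ⟨v, rfl⟩ : ∃ v, w = v + ((n : ℝ) : ℂ) • z := ⟨w - ((n : ℝ) : ℂ) • z, by abel⟩
    have e1 : x + (v + ((n : ℝ) : ℂ) • z) = (y + z) + ((1 : ℝ) : ℂ) • v := by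
      rw [hx]; push_cast; module
    rw [e1, aux_quad a ha, aux_quad b hb, aux_symm b hb v z]
    have h2 := hmle (z + ((1 / n : ℝ) : ℂ) • v)
    rw [← add_assoc, aux_quad a ha, aux_quad b hb] at h2
    have h3 : -(d / n) ≤ 2 * (1 / n) * (a (y + z) v).re + (1 / n) ^ 2 * (a v v).re
        + 2 * (b z v).re + (1 / n) * (b v v).re := by
      have : (n : ℝ) * ((b z z).re + 2 * (1 / n) * (b z v).re + (1 / n) ^ 2 * (b v v).re)
        = n * (b z z).re + 2 * (b z v).re + (1 / n) * (b v v).re := by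
        field_simp
      rw [this] at h2
      linarith
    have h4 : -d ≤ 2 * (a (y + z) v).re + (1 / n) * (a v v).re
        + 2 * n * (b z v).re + (b v v).re := by
      have := mul_le_mul_of_nonneg_left h3 hn0.le
      have e2 : (n : ℝ) * -(d / n) = -d := by field_simp
      have e3 : (n : ℝ) * (2 * (1 / n) * (a (y + z) v).re + (1 / n) ^ 2 * (a v v).re
        + 2 * (b z v).re + (1 / n) * (b v v).re) = 2 * (a (y + z) v).re + (1 / n) * (a v v).re
        + 2 * n * (b z v).re + (b v v).re := by field_simp
      rwa [e2, e3] at this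
    have h5 : (1 / n : ℝ) * (a v v).re ≤ (a v v).re :=
      mul_le_of_le_one_left (ha' v) ((div_le_one hn0).2 hn1)
    linarith
  have h6 := hs x
  have h7 : (b x x).re = (b y y).re + 2 * (1 - n) * (b y z).re + (1 - n : ℝ) ^ 2 * (b z z).re :=
    aux_quad b hb y z _
  have h8 : (b x y).re = (b y y).re + (1 - n) * (b y z).re := by
    rw [aux_symm b hb y z, hx]
    simp
  have h9 := hmle z
  have h10 := mul_nonneg (sub_nonneg.2 hn1) (hb' z)
  rw [h7, h8] at h6
  nlinarith

/-- **Corollary 2.9, form version: `a_r = (b − b:a)_b − b`.**  If `ab` is the parallel sum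
`a : b = b : a` and `a_r` is the form determined by `a_r(y,y) = lim_n (a : n·b)(y,y)`, then
`a_r(y,y) = sup { 2 Re b(x,y) − b(x,x) + (a:b)(x,x) : x ∈ E } − b(y,y)`; equivalently,
`a_r = (b − b:a)_b − b` where `(b − b:a)_b` is the smallest nonnegative form `d` with
`(b(x,x) − (b:a)(x,x)) + 2 Re b(x,y) + d(y,y) ≥ 0`. -/
theorem regular_part_eq_complement_sub
    {E : Type*} [AddCommGroup E] [Module ℂ E]
    (a b : E →ₗ[ℂ] E →ₗ⋆[ℂ] ℂ) (ha : ∀ x, 0 ≤ a x x) (hb : ∀ x, 0 ≤ b x x)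
    (ab : E →ₗ[ℂ] E →ₗ⋆[ℂ] ℂ) (hab0 : ∀ y, 0 ≤ ab y y)
    (hab : ∀ y : E, (ab y y).re =
      sInf {r : ℝ | ∃ x : E, r = (a (y + x) (y + x)).re + (b x x).re})
    (ar : E →ₗ[ℂ] E →ₗ⋆[ℂ] ℂ) (har0 : ∀ y, 0 ≤ ar y y)
    (har : ∀ y : E, Tendsto (fun n : ℕ =>
        sInf {r : ℝ | ∃ x : E, r = (a (y + x) (y + x)).re + (n : ℝ) * (b x x).re})
      atTop (𝓝 ((ar y y).re))) :
    (∀ y : E,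
      IsLUB {r : ℝ | ∃ x : E, r = 2 * (b x y).re - (b x x).re + (ab x x).re}
        ((ar y y).re + (b y y).re)) ∧
    (∀ d : E →ₗ[ℂ] E →ₗ⋆[ℂ] ℂ, (∀ y, 0 ≤ d y y) →
      (∀ x y : E, 0 ≤ ((b x x).re - (ab x x).re) + 2 * (b x y).re + (d y y).re) →
      (∀ d' : E →ₗ[ℂ] E →ₗ⋆[ℂ] ℂ, (∀ y, 0 ≤ d' y y) →
        (∀ x y : E, 0 ≤ ((b x x).re - (ab x x).re) + 2 * (b x y).re + (d' y y).re) →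
        ∀ y, (d y y).re ≤ (d' y y).re) →
      ∀ y, (ar y y).re = (d y y).re - (b y y).re) := by
  have hU : ∀ y x, 2 * (b x y).re - (b x x).re + (ab x x).re ≤ (ar y y).re + (b y y).re :=
    fun y x => aux_upper a b ha hb ab hab y _ (har y) x
  have hL : ∀ (y : E) (s : ℝ), (∀ x, 2 * (b x y).re - (b x x).re + (ab x x).re ≤ s) →
      (ar y y).re + (b y y).re ≤ s := by
    intro y s hs
    have : (ar y y).re ≤ s - (b y y).re := by
      refine le_of_tendsto (har y) ?_
      filter_upwards [eventually_ge_atTop 1] with n hn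
      exact aux_lower a b ha hb ab hab y s hs n hn
    linarith
  refine ⟨fun y => ⟨?_, ?_⟩, ?_⟩
  · rintro _ ⟨x, rfl⟩
    exact hU y x
  · intro s hs
    exact hL y s fun x => hs ⟨x, rfl⟩
  · intro d hd hd1 hd2 y
    have h1 := hL y (d y y).re (fun x => by
      have := hd1 (-x) y
      simp at this
      linarith)
    have h2 := hd2 (ar + b) (fun y => by
      simpa using add_nonneg (har0 y) (hb y)) (fun x y => by
      have := hU y (-x)
      simp at this ⊢
      linarith) y
    simp at h2
    linarith
end

section
/- Let H be a complex Hilbert space, let 𝒟 be a dense linear subspace of H, and let ι denote the nonnegative sesquilinear form on 𝒟 given by ι(x, y) = ⟪x, y⟫. Let a be any nonnegative sesquilinear form on 𝒟, and let a_r be the nonnegative form determined by a_r(y, y) = lim_{n→∞} (a : n·ι)(y, y), where (a : n·ι)(y, y) = inf{ a(y + x, y + x) + n·‖x‖² : x ∈ 𝒟 }. Then: (1) a_r is regular, i.e. for every sequence (x_n) in 𝒟 with ‖x_n‖ → 0 and a_r(x_n − x_m, x_n − x_m) → 0 as n, m → ∞ one has a_r(x_n, x_n) → 0; (2) a − a_r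 is a nonnegative form and is singular, i.e. for every x ∈ 𝒟 there exists a sequence (x_n) in 𝒟 with ‖x_n − x‖ → 0 and (a − a_r)(x_n, x_n) → 0. Thus a = a_r + (a − a_r) is a Lebesgue-type decomposition of a into a regular and a singular part. -/
open Complex Filter Topology
open scoped ComplexOrder

noncomputable def psF {V : Type*} [SeminormedAddCommGroup V] (q : V → ℝ) (n : ℕ) (y : V) : ℝ :=
  sInf {r : ℝ | ∃ x : V, r = q (y + x) + (n : ℝ) * ‖x‖ ^ 2}

theorem psF_le {V : Type*} [SeminormedAddCommGroup V] {q : V → ℝ} (hq : ∀ x, 0 ≤ q x)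
    (n : ℕ) (y x : V) : psF q n y ≤ q (y + x) + (n : ℝ) * ‖x‖ ^ 2 := by
  apply csInf_le
  · refine ⟨0, ?_⟩
    rintro r ⟨x, rfl⟩
    have := hq (y + x)
    positivity
  · exact ⟨x, rfl⟩

theorem psF_near {V : Type*} [SeminormedAddCommGroup V] (q : V → ℝ)
    (n : ℕ) (y : V) {e : ℝ} (he : 0 < e) :
    ∃ x : V, q (y + x) + (n : ℝ) * ‖x‖ ^ 2 < psF q n y + e := by
  obtain ⟨r, ⟨x, rfl⟩, h⟩ := exists_lt_of_csInf_lt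
    (s := {r : ℝ | ∃ x : V, r = q (y + x) + (n : ℝ) * ‖x‖ ^ 2}) ⟨_, 0, rfl⟩
    (show sInf _ < psF q n y + e by unfold psF; linarith)
  exact ⟨x, h⟩

theorem psF_mono {V : Type*} [SeminormedAddCommGroup V] {q : V → ℝ} (hq : ∀ x, 0 ≤ q x)
    (y : V) : Monotone (fun n => psF q n y) := by
  intro n m hnm
  apply le_of_forall_pos_lt_add
  intro e he
  obtain ⟨x, hx⟩ := psF_near q m y he
  have h1 := psF_le hq n y x
  have h2 : (n : ℝ) * ‖x‖ ^ 2 ≤ (m : ℝ) * ‖x‖ ^ 2 := by gcongr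
  show psF q n y < psF q m y + e
  linarith

theorem psF_two {V : Type*} [SeminormedAddCommGroup V] {q : V → ℝ} (hq : ∀ x, 0 ≤ q x)
    (hq2 : ∀ x y, q (x + y) ≤ 2 * q x + 2 * q y) (n : ℕ)
    (y z : V) : psF q n (y + z) ≤ 2 * psF q n y + 2 * psF q n z := by
  apply le_of_forall_pos_lt_add
  intro e he
  obtain ⟨u, hu⟩ := psF_near q n y (e := e / 4) (by linarith)
  obtain ⟨v, hv⟩ := psF_near q n z (e := e / 4) (by linarith)
  have h1 := psF_le hq n (y + z) (u + v)
  have h2 := hq2 (y + u) (z + v)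
  rw [show y + u + (z + v) = y + z + (u + v) by abel] at h2
  have h3 : ‖u + v‖ ^ 2 ≤ 2 * ‖u‖ ^ 2 + 2 * ‖v‖ ^ 2 := by
    have := norm_add_le u v
    have h0 := norm_nonneg (u + v)
    nlinarith [sq_nonneg (‖u‖ - ‖v‖)]
  have h4 : (n : ℝ) * ‖u + v‖ ^ 2 ≤ (n : ℝ) * (2 * ‖u‖ ^ 2 + 2 * ‖v‖ ^ 2) := by gcongr
  linarith

theorem psF_cont {V : Type*} [SeminormedAddCommGroup V] {q : V → ℝ} (hq : ∀ x, 0 ≤ q x)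
    (m : ℕ) (y x : V) {t : ℝ} (ht : 0 < t) :
    psF q m y ≤ (1 + t) * psF q m (y + x) + m * (1 + t⁻¹) * ‖x‖ ^ 2 := by
  apply le_of_forall_pos_lt_add
  intro e he
  obtain ⟨u, hu⟩ := psF_near q m (y + x) (e := e / (1 + t)) (by positivity)
  have h1 := psF_le hq m y (x + u)
  rw [← add_assoc] at h1
  have h0 := hq (y + x + u)
  have h3 : ‖x + u‖ ^ 2 ≤ (1 + t⁻¹) * ‖x‖ ^ 2 + (1 + t) * ‖u‖ ^ 2 := by
    have h5 : ‖x + u‖ ^ 2 ≤ (‖x‖ + ‖u‖) ^ 2 := by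
      have := norm_add_le x u
      gcongr
    have h6 : (1 + t⁻¹) * ‖x‖ ^ 2 + (1 + t) * ‖u‖ ^ 2 - (‖x‖ + ‖u‖) ^ 2
        = t⁻¹ * (‖x‖ - t * ‖u‖) ^ 2 := by field_simp; ring
    have : 0 ≤ t⁻¹ * (‖x‖ - t * ‖u‖) ^ 2 := by positivity
    linarith
  have h4 : (m : ℝ) * ‖x + u‖ ^ 2 ≤ (m : ℝ) * ((1 + t⁻¹) * ‖x‖ ^ 2 + (1 + t) * ‖u‖ ^ 2) := by
    gcongr
  have h7 : (1 + t) * (q (y + x + u) + m * ‖u‖ ^ 2) < (1 + t) * (psF q m (y + x) + e / (1 + t)) := by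
    gcongr
  have h8 : (1 + t) * (psF q m (y + x) + e / (1 + t)) = (1 + t) * psF q m (y + x) + e := by
    field_simp
  nlinarith [mul_nonneg ht.le h0]

theorem psF_regular {V : Type*} [SeminormedAddCommGroup V] {q p : V → ℝ} (hq : ∀ x, 0 ≤ q x)
    (hq0 : q 0 = 0) (hp : ∀ x, 0 ≤ p x)
    (hq2 : ∀ x y, q (x + y) ≤ 2 * q x + 2 * q y)
    (hl : ∀ y, Tendsto (fun n : ℕ => psF q n y) atTop (𝓝 (p y)))
    (x : ℕ → V) (hx : Tendsto (fun n => ‖x n‖) atTop (𝓝 0))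
    (hc : Tendsto (fun r : ℕ × ℕ => p (x r.1 - x r.2)) atTop (𝓝 0)) :
    Tendsto (fun n => p (x n)) atTop (𝓝 0) := by
  have hle : ∀ n y, psF q n y ≤ p y := fun n y => (psF_mono hq y).ge_of_tendsto (hl y) n
  rw [Metric.tendsto_atTop]
  intro e he
  obtain ⟨⟨N1, N2⟩, hN⟩ := Filter.eventually_atTop.1 (hc.eventually (gt_mem_nhds (show (0 : ℝ) < e / 4 by linarith)))
  refine ⟨N1, fun k hk => ?_⟩
  rw [Real.dist_eq, sub_zero, abs_of_nonneg (hp _)]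
  suffices p (x k) ≤ e / 2 by linarith
  refine le_of_tendsto' (hl (x k)) fun n => ?_
  have h2 : Tendsto (fun m => e / 2 + 2 * ((n : ℝ) * ‖x m‖ ^ 2)) atTop (𝓝 (e / 2)) := by
    have := ((hx.pow 2).const_mul (n : ℝ)).const_mul 2 |>.const_add (e / 2)
    simpa using this
  refine ge_of_tendsto h2 ?_
  filter_upwards [eventually_ge_atTop N2] with m hm
  have h3 := hN (k, m) ⟨hk, hm⟩
  have h4 := psF_two hq hq2 n (x k - x m) (x m)
  rw [sub_add_cancel] at h4
  have h5 := hle n (x k - x m)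
  have h6 := psF_le hq n (x m) (-x m)
  rw [add_neg_cancel, hq0, norm_neg] at h6
  simp only at h3
  linarith

theorem psF_singular {V : Type*} [SeminormedAddCommGroup V] {q p : V → ℝ} (hq : ∀ x, 0 ≤ q x)
    (hp : ∀ x, 0 ≤ p x)
    (hl : ∀ y, Tendsto (fun n : ℕ => psF q n y) atTop (𝓝 (p y)))
    (y : V) {e : ℝ} (he : 0 < e) : ∃ z, ‖z - y‖ < e ∧ q z - p z < e := by
  have hle : ∀ n y, psF q n y ≤ p y := fun n y => (psF_mono hq y).ge_of_tendsto (hl y) n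
  have hpq : ∀ y, p y ≤ q y := fun y => le_of_tendsto' (hl y) fun n => by
    simpa using psF_le hq n y 0
  have hpy := hp y
  obtain ⟨m, hm⟩ := ((hl y).eventually (lt_mem_nhds (show p y - e / 4 < p y by linarith))).exists
  set C := p y + e / 4 with hC
  have hCpos : 0 < C := by positivity
  set t := e / 4 / C with htdef
  have ht : 0 < t := by positivity
  have htC : t * C = e / 4 := by rw [htdef]; field_simp
  set K := (m : ℝ) * (1 + t⁻¹) with hK
  have hK0 : 0 ≤ K := by positivity
  obtain ⟨n, hn⟩ := exists_nat_gt (C / e ^ 2 + K * C / (e / 4))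
  have hn1 : C / e ^ 2 < n := lt_of_le_of_lt (le_add_of_nonneg_right (by positivity)) hn
  have hn2 : K * C / (e / 4) < n := lt_of_le_of_lt (le_add_of_nonneg_left (by positivity)) hn
  have hnpos : (0 : ℝ) < n := lt_of_le_of_lt (by positivity) hn1
  rw [div_lt_iff₀ (by positivity)] at hn1 hn2
  obtain ⟨x, hx⟩ := psF_near q n y (e := e / 4) (by linarith)
  have h1 := hle n y
  have h2 := hq (y + x)
  have hxC : n * ‖x‖ ^ 2 < C := by linarith
  have h3 := psF_cont hq m y x ht
  have h4 := hle m (y + x)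
  have h5 := hpq (y + x)
  have h6 : 0 ≤ (n : ℝ) * ‖x‖ ^ 2 := by positivity
  have hxe : ‖x‖ ^ 2 < e ^ 2 := lt_of_mul_lt_mul_left (hxC.trans hn1) hnpos.le
  have hKx : K * ‖x‖ ^ 2 < e / 4 := by
    refine lt_of_mul_lt_mul_left ?_ hnpos.le
    calc (n : ℝ) * (K * ‖x‖ ^ 2) = K * (n * ‖x‖ ^ 2) := by ring
      _ ≤ K * C := by gcongr
      _ < n * (e / 4) := hn2
  refine ⟨y + x, ?_, ?_⟩
  · rw [add_sub_cancel_left]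
    exact lt_of_pow_lt_pow_left₀ 2 he.le hxe
  · have h7 : t * psF q m (y + x) ≤ t * C := by
      gcongr
      linarith
    rw [← hK] at h3
    linarith

/-- **Theorem 3.3 (rigged Hilbert space Lebesgue decomposition), form version.**  Let `𝒟` be
a dense subspace of a complex Hilbert space `H` and `a` a nonnegative sesquilinear form on
`𝒟`.  If `a_r` is the form determined by
`a_r(y,y) = lim_n inf { a(y+x, y+x) + n‖x‖² : x ∈ 𝒟 }`, then `a_r` is regular and `a − a_r`
is a nonnegative singular form, so `a = a_r + (a − a_r)` is a Lebesgue-type decomposition. -/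
theorem rigged_lebesgue_decomposition
    {H : Type*} [NormedAddCommGroup H] [InnerProductSpace ℂ H] [CompleteSpace H]
    (𝒟 : Submodule ℂ H) (hdense : Dense (𝒟 : Set H))
    (a : 𝒟 →ₗ[ℂ] 𝒟 →ₗ⋆[ℂ] ℂ) (ha : ∀ x, 0 ≤ a x x)
    (ar : 𝒟 →ₗ[ℂ] 𝒟 →ₗ⋆[ℂ] ℂ) (har0 : ∀ y, 0 ≤ ar y y)
    (har : ∀ y : 𝒟, Tendsto (fun n : ℕ =>
        sInf {r : ℝ | ∃ x : 𝒟, r = (a (y + x) (y + x)).re + (n : ℝ) * ‖(x : H)‖ ^ 2})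
      atTop (𝓝 ((ar y y).re))) :
    (∀ x : ℕ → 𝒟,
      Tendsto (fun n => ‖(x n : H)‖) atTop (𝓝 0) →
      Tendsto (fun q : ℕ × ℕ =>
        (ar (x q.1 - x q.2) (x q.1 - x q.2)).re) atTop (𝓝 0) →
      Tendsto (fun n => (ar (x n) (x n)).re) atTop (𝓝 0)) ∧
    (∀ y, 0 ≤ (a - ar) y y) ∧
    (∀ x : 𝒟, ∃ s : ℕ → 𝒟,
      Tendsto (fun n => ‖(s n : H) - (x : H)‖) atTop (𝓝 0) ∧
      Tendsto (fun n => ((a - ar) (s n) (s n)).re) atTop (𝓝 0)) := by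
  have hq : ∀ x, 0 ≤ (a x x).re := fun x => (Complex.le_def.1 (ha x)).1
  have hp : ∀ x, 0 ≤ (ar x x).re := fun x => (Complex.le_def.1 (har0 x)).1
  have hq2 : ∀ x y, (a (x + y) (x + y)).re ≤ 2 * (a x x).re + 2 * (a y y).re := by
    intro x y
    have h := hq (x - y)
    simp only [map_add, map_sub, LinearMap.add_apply, LinearMap.sub_apply, Complex.add_re,
      Complex.sub_re] at h ⊢
    linarith
  have hl : ∀ y : 𝒟, Tendsto (fun n : ℕ => psF (fun x : 𝒟 => (a x x).re) n y) atTop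
      (𝓝 ((ar y y).re)) := har
  have hpq : ∀ y, (ar y y).re ≤ (a y y).re := fun y => le_of_tendsto' (hl y) fun n => by
    simpa using psF_le (q := fun x : 𝒟 => (a x x).re) hq n y 0
  refine ⟨?_, ?_, ?_⟩
  · intro x hx hc
    exact psF_regular (q := fun x : 𝒟 => (a x x).re) (p := fun x : 𝒟 => (ar x x).re)
      hq (by simp) hp hq2 hl x hx hc
  · intro y
    have h1 := (Complex.le_def.1 (ha y)).2
    have h2 := (Complex.le_def.1 (har0 y)).2
    rw [Complex.le_def]
    simp only [LinearMap.sub_apply, Complex.sub_re, Complex.sub_im, Complex.zero_re,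
      Complex.zero_im] at h1 h2 ⊢
    exact ⟨by linarith [hpq y], by linarith⟩
  · intro x
    have hs := fun n : ℕ => psF_singular (q := fun x : 𝒟 => (a x x).re)
      (p := fun x : 𝒟 => (ar x x).re) hq hp hl x (e := 1 / ((n : ℝ) + 1)) (by positivity)
    choose s hs1 hs2 using hs
    refine ⟨s, ?_, ?_⟩
    · exact squeeze_zero (fun n => norm_nonneg _) (fun n => (hs1 n).le)
        tendsto_one_div_add_atTop_nhds_zero_nat
    · refine squeeze_zero (fun n => ?_) (fun n => ?_) tendsto_one_div_add_atTop_nhds_zero_nat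
      · simpa using hpq (s n)
      · simpa using (hs2 n).le
end
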